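/- Let ζ ∈ ℂ be a root of Z⁴+Z³+Z²+Z+1. For i ∈ {1,2,3,4} set α = ζ^i and let B^i be the arrangement of 11 lines: L1: z=0, L2: x=0, L3: x−z=0, L4: x+(−α³−α²)y=0, L5: y=0, L6: αx+y=0, L7: y−z=0, L8: (−α³−α²−α−1)y+z=0, L9: α²x+αy+z=0, L10: −α²x+y+(−α³−α²−α−1)z=0, L11: α²x−y+z=0. Then for i ≠ j ∈ {1,2,3,4} with i + j ≢ 0 (mod 5), there is no homeomorphism h of ℂℙ² onto itself with h(Z(B^i)) = Z(B^j); thus (B^i, B^j) is a Zariski pair. -/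

import Mathlib

/- The complex projective plane `ℂℙ²`, with its quotient topology, and projective
lines given as zero loci of linear forms in the homogeneous coordinates. -/

open scoped LinearAlgebra.Projectivization
open Projectivization

noncomputable section

abbrev CP2 := ℙ ℂ (Fin 3 → ℂ)

instance : TopologicalSpace CP2 :=
  inferInstanceAs (TopologicalSpace (Quotient (projectivizationSetoid ℂ (Fin 3 → ℂ))))

/-- The projective line `{[x:y:z] | a*x + b*y + c*z = 0}`.  (The zero locus of a linear
form is well defined on any representative, so we may use the representative `p.rep`.) -/
def projLine (a b c : ℂ) : Set CP2 :=
  {p | a * p.rep 0 + b * p.rep 1 + c * p.rep 2 = 0}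

/-- The lines of the arrangement `B^i` of Appendix B.2, where `α = ζ^i`. -/
def B2line (α : ℂ) : Fin 11 → Set CP2 :=
  ![projLine 0 0 1,
    projLine 1 0 0,
    projLine 1 0 (-1),
    projLine 1 (-α^3 - α^2) 0,
    projLine 0 1 0,
    projLine α 1 0,
    projLine 0 1 (-1),
    projLine 0 (-α^3 - α^2 - α - 1) 1,
    projLine (α^2) α 1,
    projLine (-α^2) 1 (-α^3 - α^2 - α - 1),
    projLine (α^2) (-1) 1]

/-- The linear form with coefficients `c`. -/
def lf (c v : Fin 3 → ℂ) : ℂ := c 0 * v 0 + c 1 * v 1 + c 2 * v 2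

/-- The projective line with coefficient vector `c`. -/
def PL (c : Fin 3 → ℂ) : Set CP2 := projLine (c 0) (c 1) (c 2)

lemma lf_smul (c v : Fin 3 → ℂ) (a : ℂ) : lf c (a • v) = a * lf c v := by
  simp [lf]; ring

lemma exists_rep (v : Fin 3 → ℂ) (hv : v ≠ 0) :
    ∃ a : ℂ, a ≠ 0 ∧ (Projectivization.mk ℂ v hv).rep = a • v := by
  obtain ⟨a, ha⟩ := Projectivization.exists_smul_eq_mk_rep ℂ v hv
  exact ⟨a, a.ne_zero, by rw [← ha]; rfl⟩

lemma mem_PL (c v : Fin 3 → ℂ) (hv : v ≠ 0) :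
    Projectivization.mk ℂ v hv ∈ PL c ↔ lf c v = 0 := by
  obtain ⟨a, ha, h⟩ := exists_rep v hv
  have : Projectivization.mk ℂ v hv ∈ PL c ↔ lf c (Projectivization.mk ℂ v hv).rep = 0 := Iff.rfl
  rw [this, h, lf_smul]
  simp [ha]

/-- Ratio of two linear forms. -/
def rt (c d : Fin 3 → ℂ) (p : CP2) : ℂ := lf c p.rep / lf d p.rep

lemma rt_mk (c d v : Fin 3 → ℂ) (hv : v ≠ 0) :
    rt c d (Projectivization.mk ℂ v hv) = lf c v / lf d v := by
  obtain ⟨a, ha, h⟩ := exists_rep v hv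
  rw [rt, h, lf_smul, lf_smul, mul_div_mul_left _ _ ha]

/-- The quotient map. -/
def qm (v : {v : Fin 3 → ℂ // v ≠ 0}) : CP2 := Projectivization.mk ℂ v.1 v.2

lemma qm_quot : Topology.IsQuotientMap qm := isQuotientMap_quot_mk

lemma lf_cont (c : Fin 3 → ℂ) : Continuous (lf c) := by
  unfold lf; fun_prop

lemma PL_closed (c : Fin 3 → ℂ) : IsClosed (PL c) := by
  rw [← qm_quot.isClosed_preimage]
  have : qm ⁻¹' PL c = {v | lf c v.1 = 0} := by
    ext v; exact mem_PL c v.1 v.2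
  rw [this]
  exact isClosed_eq ((lf_cont c).comp continuous_subtype_val) continuous_const

lemma rt_contOn (c d : Fin 3 → ℂ) : ContinuousOn (rt c d) (PL d)ᶜ := by
  rw [qm_quot.continuousOn_isOpen_iff (PL_closed d).isOpen_compl]
  have : ContinuousOn (fun v : {v : Fin 3 → ℂ // v ≠ 0} => lf c v.1 / lf d v.1)
      (qm ⁻¹' (PL d)ᶜ) := by
    apply ContinuousOn.div
    · exact ((lf_cont c).comp continuous_subtype_val).continuousOn
    · exact ((lf_cont d).comp continuous_subtype_val).continuousOn
    · intro v hv h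
      exact hv ((mem_PL d v.1 v.2).2 h)
  exact this.congr (fun v _ => rt_mk c d v.1 v.2)

lemma mk_cont {X : Type*} [TopologicalSpace X] {u : X → Fin 3 → ℂ} (hu : Continuous u)
    (h : ∀ t, u t ≠ 0) : Continuous (fun t => (Projectivization.mk ℂ (u t) (h t) : CP2)) :=
  qm_quot.continuous.comp (hu.subtype_mk h)

lemma rt_ne {c d : Fin 3 → ℂ} {p : CP2} (h1 : p ∉ PL c) (h2 : p ∉ PL d) : rt c d p ≠ 0 :=
  div_ne_zero h1 h2

/-- Determinant of three forms. -/
def dt (c d e : Fin 3 → ℂ) : ℂ :=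
  c 0 * (d 1 * e 2 - d 2 * e 1) + c 1 * (d 2 * e 0 - d 0 * e 2) + c 2 * (d 0 * e 1 - d 1 * e 0)

/-- The vector on which the forms `c, d, e` take the values `a, b, f`. -/
def sol (c d e : Fin 3 → ℂ) (a b f : ℂ) : Fin 3 → ℂ :=
  ![(a * (d 1 * e 2 - d 2 * e 1) + b * (e 1 * c 2 - e 2 * c 1) + f * (c 1 * d 2 - c 2 * d 1))
      / dt c d e,
    (a * (d 2 * e 0 - d 0 * e 2) + b * (e 2 * c 0 - e 0 * c 2) + f * (c 2 * d 0 - c 0 * d 2))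
      / dt c d e,
    (a * (d 0 * e 1 - d 1 * e 0) + b * (e 0 * c 1 - e 1 * c 0) + f * (c 0 * d 1 - c 1 * d 0))
      / dt c d e]

lemma lf_sol1 {c d e : Fin 3 → ℂ} (h : dt c d e ≠ 0) (a b f : ℂ) :
    lf c (sol c d e a b f) = a := by
  simp only [lf, sol, Matrix.cons_val]
  field_simp
  unfold dt; ring

lemma lf_sol2 {c d e : Fin 3 → ℂ} (h : dt c d e ≠ 0) (a b f : ℂ) :
    lf d (sol c d e a b f) = b := by
  simp only [lf, sol, Matrix.cons_val]
  field_simp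
  unfold dt; ring

lemma lf_sol3 {c d e : Fin 3 → ℂ} (h : dt c d e ≠ 0) (a b f : ℂ) :
    lf e (sol c d e a b f) = f := by
  simp only [lf, sol, Matrix.cons_val]
  field_simp
  unfold dt; ring

lemma sol_lf {c d e : Fin 3 → ℂ} (h : dt c d e ≠ 0) (v : Fin 3 → ℂ) :
    sol c d e (lf c v) (lf d v) (lf e v) = v := by
  ext i
  fin_cases i <;> simp [sol] <;> field_simp <;> unfold dt lf <;> ring

lemma sol_smul (c d e : Fin 3 → ℂ) (a b f r : ℂ) :
    sol c d e (r * a) (r * b) (r * f) = r • sol c d e a b f := by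
  ext i
  fin_cases i <;> simp [sol] <;> ring

lemma sol_zero (c d e : Fin 3 → ℂ) : sol c d e 0 0 0 = 0 := by
  ext i
  fin_cases i <;> simp [sol]

lemma lf_zero (c : Fin 3 → ℂ) : lf c 0 = 0 := by simp [lf]

lemma sol_cont {X : Type*} [TopologicalSpace X] (c d e : Fin 3 → ℂ) {a b f : X → ℂ}
    (ha : Continuous a) (hb : Continuous b) (hf : Continuous f) :
    Continuous (fun t => sol c d e (a t) (b t) (f t)) := by
  apply continuous_pi
  intro i
  fin_cases i <;> simp only [sol] <;> simp <;> fun_prop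

/-- A continuous function on a preconnected set whose values there lie in a countable set
is constant. -/
lemma const_of_countable {X : Type*} [TopologicalSpace X] {S : Set X} (hS : IsPreconnected S)
    {f : X → ℂ} (hf : ContinuousOn f S) {C : Set ℂ} (hC : C.Countable)
    (hm : ∀ x ∈ S, f x ∈ C) {x y : X} (hx : x ∈ S) (hy : y ∈ S) : f x = f y := by
  have h1 : IsPreconnected (f '' S) := hS.image f hf
  have h2 : (f '' S).Subsingleton :=
    hC.isTotallyDisconnected (f '' S) (by rintro _ ⟨x, hx, rfl⟩; exact hm x hx) h1
  exact h2 ⟨x, hx, rfl⟩ ⟨y, hy, rfl⟩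

lemma exp_fiber_countable (c : ℂ) : {z : ℂ | Complex.exp z = c}.Countable := by
  by_cases h : ∃ z0, Complex.exp z0 = c
  · obtain ⟨z0, h0⟩ := h
    apply (Set.countable_range (fun n : ℤ => z0 + n * (2 * Real.pi * Complex.I))).mono
    intro z hz
    have : Complex.exp z = Complex.exp z0 := by rw [h0]; exact hz
    obtain ⟨n, hn⟩ := Complex.exp_eq_exp_iff_exists_int.1 this
    exact ⟨n, hn.symm⟩
  · have : {z : ℂ | Complex.exp z = c} = ∅ := by
      ext z; simp; intro hz; exact h ⟨z, hz⟩
    rw [this]; exact Set.countable_empty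

lemma const_of_exp {X : Type*} [TopologicalSpace X] {S : Set X} (hS : IsPreconnected S)
    {f : X → ℂ} (hf : ContinuousOn f S) {c : ℂ}
    (hm : ∀ x ∈ S, Complex.exp (f x) = c) {x y : X} (hx : x ∈ S) (hy : y ∈ S) : f x = f y :=
  const_of_countable hS hf (exp_fiber_countable c) hm hx hy

/-- Continuous logarithms on `ℂ × ℂ`. -/
lemma exists_log (F : ℂ × ℂ → ℂ) (hF : Continuous F) (h0 : ∀ x, F x ≠ 0) :
    ∃ G : ℂ × ℂ → ℂ, Continuous G ∧ ∀ x, Complex.exp (G x) = F x := by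
  obtain ⟨G, hG, -⟩ := Complex.isCoveringMap_exp.existsUnique_continuousMap_lifts
    (⟨fun x => (⟨F x, h0 x⟩ : {z : ℂ // z ≠ 0}), hF.subtype_mk _⟩ : C(ℂ × ℂ, {z : ℂ // z ≠ 0}))
    (a₀ := (0 : ℂ × ℂ)) (e₀ := Complex.log (F 0)) (by
      ext; simp [Complex.exp_log (h0 0)])
  refine ⟨G, G.continuous, fun x => ?_⟩
  have := congrFun hG.2 x
  exact congrArg Subtype.val this

/-- Maps from the complement of two lines to `ℂ*`. -/
lemma classify {c d e : Fin 3 → ℂ} (h : dt c d e ≠ 0) (F : CP2 → ℂ)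
    (hF : ContinuousOn F (PL c ∪ PL d)ᶜ) (h0 : ∀ p ∈ (PL c ∪ PL d)ᶜ, F p ≠ 0) :
    ∃ n : ℤ, ∃ g : CP2 → ℂ, ContinuousOn g (PL c ∪ PL d)ᶜ ∧
      ∀ p ∈ (PL c ∪ PL d)ᶜ, F p = rt c d p ^ n * Complex.exp (g p) := by
  have hne : ∀ x : ℂ × ℂ, sol c d e (Complex.exp x.1) 1 x.2 ≠ 0 := by
    intro x hx
    have := lf_sol2 h (Complex.exp x.1) 1 x.2
    rw [hx, lf_zero] at this
    exact zero_ne_one this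
  set π : ℂ × ℂ → CP2 := fun x => Projectivization.mk ℂ _ (hne x) with hπ
  have hπc : Continuous π := mk_cont (sol_cont c d e (by fun_prop) (by fun_prop) (by fun_prop)) hne
  have hπm : ∀ x, π x ∈ (PL c ∪ PL d)ᶜ := by
    rintro x (hx | hx)
    · rw [hπ, mem_PL, lf_sol1 h] at hx
      exact Complex.exp_ne_zero _ hx
    · rw [hπ, mem_PL, lf_sol2 h] at hx
      exact one_ne_zero hx
  obtain ⟨G, hGc, hG⟩ := exists_log (fun x => F (π x))
    (hF.comp_continuous hπc hπm) (fun x => h0 _ (hπm x))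
  have hper : ∀ s t, π (s + 2 * Real.pi * Complex.I, t) = π (s, t) := by
    intro s t
    simp only [hπ]
    congr 2
    exact Complex.exp_periodic s
  -- the period
  have hpi : (2 * Real.pi * Complex.I : ℂ) ≠ 0 := Complex.two_pi_I_ne_zero
  obtain ⟨n, hn⟩ : ∃ n : ℤ, G (0 + 2 * Real.pi * Complex.I, 0) = G (0, 0) + n * (2 * Real.pi * Complex.I) := by
    apply Complex.exp_eq_exp_iff_exists_int.1
    rw [hG, hG, hper]
  have hn' : ∀ s t, G (s + 2 * Real.pi * Complex.I, t) = G (s, t) + n * (2 * Real.pi * Complex.I) := by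
    intro s t
    have := const_of_exp (S := (Set.univ : Set (ℂ × ℂ))) isPreconnected_univ
      (f := fun x => G (x.1 + 2 * Real.pi * Complex.I, x.2) - G x) (c := 1)
      (by apply Continuous.continuousOn; fun_prop)
      (by
        rintro ⟨s, t⟩ -
        simp only
        rw [Complex.exp_sub, hG, hG, hper, div_self (h0 _ (hπm _))])
      (Set.mem_univ (s, t)) (Set.mem_univ (0, 0))
    simp only at this
    rw [hn] at this
    linear_combination this
  set H : ℂ × ℂ → ℂ := fun x => G x - n * x.1 with hH
  have hHc : Continuous H := by rw [hH]; fun_prop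
  have hH1 : ∀ s t, H (s + 2 * Real.pi * Complex.I, t) = H (s, t) := by
    intro s t
    simp only [hH, hn']; ring
  have hH2 : ∀ t, ∀ k : ℤ, ∀ s, H (s + k * (2 * Real.pi * Complex.I), t) = H (s, t) := by
    intro t k
    have : Function.Periodic (fun s => H (s, t)) (2 * Real.pi * Complex.I) := fun s => hH1 s t
    exact this.int_mul k
  have hH3 : ∀ t s s', Complex.exp s = Complex.exp s' → H (s, t) = H (s', t) := by
    intro t s s' hs
    obtain ⟨k, hk⟩ := Complex.exp_eq_exp_iff_exists_int.1 hs
    rw [hk, hH2]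
  have hX : ∀ p ∈ (PL c ∪ PL d)ᶜ, rt c d p ≠ 0 := fun p hp =>
    rt_ne (fun h => hp (Or.inl h)) (fun h => hp (Or.inr h))
  have hXo : IsOpen (PL c ∪ PL d)ᶜ := ((PL_closed c).union (PL_closed d)).isOpen_compl
  refine ⟨n, fun p => H (Complex.log (rt c d p), rt e d p), ?_, ?_⟩
  · intro p0 hp0
    apply ContinuousAt.continuousWithinAt
    have e1 : ContinuousAt (rt c d) p0 :=
      (rt_contOn c d).continuousAt ((PL_closed d).isOpen_compl.mem_nhds fun h => hp0 (Or.inr h))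
    have e2 : ContinuousAt (rt e d) p0 :=
      (rt_contOn e d).continuousAt ((PL_closed d).isOpen_compl.mem_nhds fun h => hp0 (Or.inr h))
    have e3 : ContinuousAt (fun p => H (Complex.log (rt c d p / rt c d p0) + Complex.log (rt c d p0),
        rt e d p)) p0 := by
      apply hHc.continuousAt.comp
      apply ContinuousAt.prodMk _ e2
      apply ContinuousAt.add _ continuousAt_const
      apply ContinuousAt.clog
      · exact e1.div_const _
      · rw [div_self (hX p0 hp0)]; exact Complex.one_mem_slitPlane
    apply e3.congr
    filter_upwards [hXo.mem_nhds hp0] with p hp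
    apply hH3
    rw [Complex.exp_add, Complex.exp_log (div_ne_zero (hX p hp) (hX p0 hp0)),
      Complex.exp_log (hX p0 hp0), Complex.exp_log (hX p hp), div_mul_cancel₀ _ (hX p0 hp0)]
  · intro p hp
    have hπp : π (Complex.log (rt c d p), rt e d p) = p := by
      simp only [hπ]
      induction p using Projectivization.ind with
      | h v hv =>
        have hd : lf d v ≠ 0 := fun h => hp (Or.inr ((mem_PL d v hv).2 h))
        rw [Projectivization.mk_eq_mk_iff']
        refine ⟨(lf d v)⁻¹, ?_⟩
        rw [Complex.exp_log (hX _ hp), rt_mk, rt_mk]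
        have hv' := sol_lf h v
        calc (lf d v)⁻¹ • v = (lf d v)⁻¹ • sol c d e (lf c v) (lf d v) (lf e v) := by rw [hv']
          _ = _ := by
            rw [← sol_smul]
            congr 1 <;> field_simp
    have h2 : F p = Complex.exp (G (Complex.log (rt c d p), rt e d p)) := by rw [hG, hπp]
    rw [h2]
    simp only [hH]
    rw [Complex.exp_sub, Complex.exp_int_mul, Complex.exp_log (hX p hp)]
    rw [mul_div_cancel₀ _ (zpow_ne_zero _ (hX p hp))]

lemma zpow_not_exp {c d e : Fin 3 → ℂ} (h : dt c d e ≠ 0) (k : ℤ) (g : CP2 → ℂ)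
    (hg : ContinuousOn g (PL c ∪ PL d ∪ PL e)ᶜ)
    (hk : ∀ p ∈ (PL c ∪ PL d ∪ PL e)ᶜ, rt c d p ^ k = Complex.exp (g p)) : k = 0 := by
  have hne : ∀ x : ℝ, sol c d e (Complex.exp (x * Complex.I)) 1 1 ≠ 0 := by
    intro x hx
    have := lf_sol2 h (Complex.exp (x * Complex.I)) 1 1
    rw [hx, lf_zero] at this
    exact zero_ne_one this
  set γ : ℝ → CP2 := fun x => Projectivization.mk ℂ _ (hne x) with hγ
  have hγc : Continuous γ := mk_cont (sol_cont c d e (by fun_prop) (by fun_prop) (by fun_prop)) hne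
  have hγm : ∀ x, γ x ∈ (PL c ∪ PL d ∪ PL e)ᶜ := by
    rintro x ((hx | hx) | hx)
    · rw [hγ, mem_PL, lf_sol1 h] at hx
      exact Complex.exp_ne_zero _ hx
    · rw [hγ, mem_PL, lf_sol2 h] at hx
      exact one_ne_zero hx
    · rw [hγ, mem_PL, lf_sol3 h] at hx
      exact one_ne_zero hx
  have hper : γ (2 * Real.pi) = γ 0 := by
    simp only [hγ]
    congr 2
    push_cast
    rw [Complex.exp_two_pi_mul_I]; simp
  have hc : Continuous (fun x => g (γ x)) := hg.comp_continuous hγc hγm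
  have := const_of_exp (S := (Set.univ : Set ℝ)) isPreconnected_univ
      (f := fun x => g (γ x) - k * (x * Complex.I)) (c := 1)
      (Continuous.continuousOn (hc.sub (by fun_prop)))
      (by
        intro x _
        rw [Complex.exp_sub, ← hk _ (hγm x), Complex.exp_int_mul, hγ, rt_mk, lf_sol1 h, lf_sol2 h,
          div_one, div_self]
        exact zpow_ne_zero _ (Complex.exp_ne_zero _))
      (Set.mem_univ (2 * Real.pi)) (Set.mem_univ 0)
  simp only [hper] at this
  have hpi : (2 * Real.pi * Complex.I : ℂ) ≠ 0 := Complex.two_pi_I_ne_zero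
  have h2 : (k : ℂ) * (2 * Real.pi * Complex.I) = 0 := by
    push_cast at this
    linear_combination -this
  rcases mul_eq_zero.1 h2 with h3 | h3
  · exact_mod_cast h3
  · exact absurd h3 hpi

lemma pull {c d e c' d' e' : Fin 3 → ℂ} (hd : dt c d e ≠ 0) (hd' : dt c' d' e' ≠ 0)
    (h : CP2 ≃ₜ CP2) (h1 : ∀ p, h p ∈ PL c' ↔ p ∈ PL c) (h2 : ∀ p, h p ∈ PL d' ↔ p ∈ PL d) :
    ∃ n : ℤ, (n = 1 ∨ n = -1) ∧ ∃ g : CP2 → ℂ, ContinuousOn g (PL c ∪ PL d)ᶜ ∧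
      ∀ p ∈ (PL c ∪ PL d)ᶜ, rt c' d' (h p) = rt c d p ^ n * Complex.exp (g p) := by
  have hm : ∀ p, h p ∈ (PL c' ∪ PL d')ᶜ ↔ p ∈ (PL c ∪ PL d)ᶜ := by
    intro p; simp [h1, h2]
  have hm' : ∀ p, h.symm p ∈ (PL c ∪ PL d)ᶜ ↔ p ∈ (PL c' ∪ PL d')ᶜ := by
    intro p; rw [← hm]; simp
  have hr : ∀ (c d : Fin 3 → ℂ), ∀ p ∈ (PL c ∪ PL d)ᶜ, rt c d p ≠ 0 := fun c d p hp =>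
    rt_ne (fun h => hp (Or.inl h)) (fun h => hp (Or.inr h))
  have hrc : ∀ (c d : Fin 3 → ℂ), ContinuousOn (rt c d) (PL c ∪ PL d)ᶜ := fun c d =>
    (rt_contOn c d).mono (fun p hp h => hp (Or.inr h))
  obtain ⟨n, g, hg, hn⟩ := classify hd (fun p => rt c' d' (h p))
    ((hrc c' d').comp h.continuous.continuousOn (fun p hp => (hm p).2 hp))
    (fun p hp => hr _ _ _ ((hm p).2 hp))
  obtain ⟨n', g', hg', hn'⟩ := classify hd' (fun p => rt c d (h.symm p))
    ((hrc c d).comp h.symm.continuous.continuousOn (fun p hp => (hm' p).2 hp))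
    (fun p hp => hr _ _ _ ((hm' p).2 hp))
  refine ⟨n, ?_, g, hg, hn⟩
  have key : 1 - n * n' = 0 := by
    have hsub : (PL c ∪ PL d ∪ PL e)ᶜ ⊆ (PL c ∪ PL d)ᶜ := fun p hp h => hp (Or.inl h)
    apply zpow_not_exp hd _ (fun p => n' * g p + g' (h p))
    · apply ContinuousOn.add
      · exact continuousOn_const.mul (hg.mono hsub)
      · exact hg'.comp h.continuous.continuousOn (fun p hp => (hm p).2 (hsub hp))
    · intro p hp
      have a1 := hn p (hsub hp)
      have a2 := hn' (h p) ((hm p).2 (hsub hp))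
      rw [h.symm_apply_apply, a1, mul_zpow, ← zpow_mul, ← Complex.exp_int_mul] at a2
      have hne := hr c d p (hsub hp)
      rw [zpow_sub₀ hne, zpow_one, Complex.exp_add, div_eq_iff (zpow_ne_zero _ hne)]
      linear_combination a2
  have : n * n' = 1 := by omega
  exact Int.isUnit_iff.1 (IsUnit.of_mul_eq_one _ this)

lemma dt_perm1 {c d e : Fin 3 → ℂ} (h : dt c d e ≠ 0) : dt c e d ≠ 0 := by
  intro h'; apply h; rw [← neg_eq_zero, ← h']; unfold dt; ring

lemma dt_perm2 {c d e : Fin 3 → ℂ} (h : dt c d e ≠ 0) : dt e d c ≠ 0 := by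
  intro h'; apply h; rw [← neg_eq_zero, ← h']; unfold dt; ring

lemma sign_eq {c d e c' d' e' : Fin 3 → ℂ} (hd : dt c d e ≠ 0) (hd' : dt c' d' e' ≠ 0)
    (h : CP2 ≃ₜ CP2) (h1 : ∀ p, h p ∈ PL c' ↔ p ∈ PL c) (h2 : ∀ p, h p ∈ PL d' ↔ p ∈ PL d)
    (h3 : ∀ p, h p ∈ PL e' ↔ p ∈ PL e)
    {n1 n2 : ℤ} (hn1 : n1 = 1 ∨ n1 = -1) (hn2 : n2 = 1 ∨ n2 = -1) {g1 g2 : CP2 → ℂ}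
    (hg1 : ContinuousOn g1 (PL c ∪ PL d)ᶜ) (hg2 : ContinuousOn g2 (PL e ∪ PL d)ᶜ)
    (e1 : ∀ p ∈ (PL c ∪ PL d)ᶜ, rt c' d' (h p) = rt c d p ^ n1 * Complex.exp (g1 p))
    (e2 : ∀ p ∈ (PL e ∪ PL d)ᶜ, rt e' d' (h p) = rt e d p ^ n2 * Complex.exp (g2 p)) :
    n1 = n2 := by
  obtain ⟨n3, hn3, g3, hg3, e3⟩ := pull (dt_perm1 hd) (dt_perm1 hd') h h1 h3
  set X := (PL c ∪ PL d ∪ PL e)ᶜ with hX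
  have k1 : ContinuousOn g1 X := hg1.mono (by intro p hp; simp [hX] at hp ⊢; tauto)
  have k2 : ContinuousOn g2 X := hg2.mono (by intro p hp; simp [hX] at hp ⊢; tauto)
  have k3 : ContinuousOn g3 X := hg3.mono (by intro p hp; simp [hX] at hp ⊢; tauto)
  have key : ∀ p ∈ X, rt c d p ^ n1 * Complex.exp (g1 p) * rt e d p ^ n3 =
      rt c d p ^ n3 * rt e d p ^ n2 * Complex.exp (g2 p + g3 p) ∧ rt c d p ≠ 0 ∧ rt e d p ≠ 0 := by
    intro p hp
    have pc : p ∉ PL c := by simp [hX] at hp; tauto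
    have pd : p ∉ PL d := by simp [hX] at hp; tauto
    have pe : p ∉ PL e := by simp [hX] at hp; tauto
    have hce : ∀ (c d e : Fin 3 → ℂ) p, p ∉ PL d → p ∉ PL e → rt c e p * rt e d p = rt c d p := by
      intro c d e p hd he
      have hd' : lf d p.rep ≠ 0 := hd
      have he' : lf e p.rep ≠ 0 := he
      unfold rt; field_simp
    have q := hce c' d' e' (h p) (fun hh => pd ((h2 p).1 hh)) (fun hh => pe ((h3 p).1 hh))
    rw [e1 p (by simp; tauto), e2 p (by simp; tauto), e3 p (by simp; tauto)] at q
    have q2 := hce c d e p pd pe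
    have r1 := rt_ne pc pd
    have r2 := rt_ne pe pd
    refine ⟨?_, r1, r2⟩
    rw [← q, Complex.exp_add, ← q2, mul_zpow]
    ring
  by_contra hne
  have hcase : n3 = n1 ∨ n3 = n2 := by omega
  rcases hcase with h0 | h0
  · have := zpow_not_exp (dt_perm2 hd) (n1 - n2) (fun p => g2 p + g3 p - g1 p)
      (by
        have : (PL e ∪ PL d ∪ PL c)ᶜ = X := by rw [hX]; ext p; simp; tauto
        rw [this]
        exact (k2.add k3).sub k1)
      (by
        intro p hp
        obtain ⟨q, r1, r2⟩ := key p (by simp [hX] at hp ⊢; tauto)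
        rw [zpow_sub₀ r2, Complex.exp_sub, div_eq_div_iff (zpow_ne_zero _ r2) (Complex.exp_ne_zero _)]
        subst h0
        apply mul_left_cancel₀ (zpow_ne_zero n3 r1)
        linear_combination q)
    omega
  · have := zpow_not_exp hd (n1 - n2) (fun p => g2 p + g3 p - g1 p) ((k2.add k3).sub k1)
      (by
        intro p hp
        obtain ⟨q, r1, r2⟩ := key p hp
        rw [zpow_sub₀ r1, Complex.exp_sub, div_eq_div_iff (zpow_ne_zero _ r1) (Complex.exp_ne_zero _)]
        subst h0
        apply mul_left_cancel₀ (zpow_ne_zero n3 r2)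
        linear_combination q)
    omega

lemma inter_subsingleton {c d e : Fin 3 → ℂ} (h : dt c d e ≠ 0) : (PL c ∩ PL d).Subsingleton := by
  rintro p ⟨hp1, hp2⟩ q ⟨hq1, hq2⟩
  induction p using Projectivization.ind with
  | h v hv =>
    induction q using Projectivization.ind with
    | h w hw =>
      rw [mem_PL] at *
      have hv' := sol_lf h v
      have hw' := sol_lf h w
      rw [hp1, hp2] at hv'
      rw [hq1, hq2] at hw'
      have hw0 : lf e w ≠ 0 := by
        intro h0
        rw [h0, sol_zero] at hw'
        exact hw hw'.symm
      rw [Projectivization.mk_eq_mk_iff']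
      refine ⟨lf e v / lf e w, ?_⟩
      calc (lf e v / lf e w) • w = (lf e v / lf e w) • sol c d e 0 0 (lf e w) := by rw [hw']
        _ = v := by
          rw [← sol_smul, mul_zero, div_mul_cancel₀ _ hw0, hv']

lemma line_param {c d e : Fin 3 → ℂ} (h : dt c d e ≠ 0) (F : Set CP2) (hF : F.Finite) :
    IsPreconnected (PL c \ (PL d ∪ F)) ∧ PL c ⊆ closure (PL c \ (PL d ∪ F)) := by
  have hne : ∀ x : ℂ, sol c d e 0 1 x ≠ 0 := by
    intro x hx
    have := lf_sol2 h 0 1 x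
    rw [hx, lf_zero] at this
    exact zero_ne_one this
  have hne' : ∀ x : ℂ, sol c d e 0 x 1 ≠ 0 := by
    intro x hx
    have := lf_sol3 h 0 x 1
    rw [hx, lf_zero] at this
    exact zero_ne_one this
  set φ : ℂ → CP2 := fun x => Projectivization.mk ℂ _ (hne x) with hφ
  set ψ : ℂ → CP2 := fun x => Projectivization.mk ℂ _ (hne' x) with hψ
  have hφc : Continuous φ := mk_cont (sol_cont c d e (by fun_prop) (by fun_prop) (by fun_prop)) hne
  have hψc : Continuous ψ := mk_cont (sol_cont c d e (by fun_prop) (by fun_prop) (by fun_prop)) hne'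
  have hφi : Function.Injective φ := by
    intro s t hst
    have : ∀ t, rt e d (φ t) = t := by
      intro t; rw [hφ, rt_mk, lf_sol2 h, lf_sol3 h, div_one]
    rw [← this s, hst, this]
  have hφm : ∀ t, φ t ∈ PL c ∧ φ t ∉ PL d := by
    intro t
    rw [hφ, mem_PL, mem_PL, lf_sol1 h, lf_sol2 h]; simp
  have hψφ : ∀ s, s ≠ 0 → ψ s = φ s⁻¹ := by
    intro s hs
    simp only [hψ, hφ]
    rw [Projectivization.mk_eq_mk_iff']
    refine ⟨s, ?_⟩
    rw [← sol_smul, mul_zero, mul_one, mul_inv_cancel₀ hs]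
  have hsurj : ∀ p ∈ PL c, p ∉ PL d → p = φ (rt e d p) := by
    intro p hp hpd
    induction p using Projectivization.ind with
    | h v hv =>
      rw [mem_PL] at hp hpd
      simp only [hφ]
      symm
      rw [Projectivization.mk_eq_mk_iff']
      refine ⟨(lf d v)⁻¹, ?_⟩
      rw [rt_mk]
      have hv' := sol_lf h v
      calc (lf d v)⁻¹ • v = (lf d v)⁻¹ • sol c d e (lf c v) (lf d v) (lf e v) := by rw [hv']
        _ = _ := by
          rw [← sol_smul, hp, mul_zero, inv_mul_cancel₀ hpd, inv_mul_eq_div]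
  have hsurj' : ∀ p ∈ PL c, p ∈ PL d → p = ψ 0 := by
    intro p hp hpd
    apply inter_subsingleton h ⟨hp, hpd⟩
    simp only [hψ, Set.mem_inter_iff]
    rw [mem_PL, mem_PL, lf_sol1 h, lf_sol2 h]; simp
  have hfin : (φ ⁻¹' F).Finite := hF.preimage hφi.injOn
  have himg : PL c \ (PL d ∪ F) = φ '' (φ ⁻¹' F)ᶜ := by
    ext p
    constructor
    · rintro ⟨hp, hp2⟩
      have := hsurj p hp (fun h => hp2 (Or.inl h))
      refine ⟨_, ?_, this.symm⟩
      intro hh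
      exact hp2 (Or.inr (by rw [this]; exact hh))
    · rintro ⟨t, ht, rfl⟩
      exact ⟨(hφm t).1, fun hh => hh.elim (hφm t).2 ht⟩
  have hrank : 1 < Module.rank ℝ ℂ := by simp
  rw [himg]
  refine ⟨(hfin.countable.isConnected_compl_of_one_lt_rank hrank).isPreconnected.image _ hφc.continuousOn, ?_⟩
  have hdense : Dense (φ ⁻¹' F)ᶜ := hfin.countable.dense_compl ℝ
  have hcl : ∀ t, φ t ∈ closure (φ '' (φ ⁻¹' F)ᶜ) := fun t =>
    image_closure_subset_closure_image hφc ⟨t, hdense t, rfl⟩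
  intro p hp
  by_cases hpd : p ∈ PL d
  · rw [hsurj' p hp hpd]
    have hcl2 : IsClosed (ψ ⁻¹' closure (φ '' (φ ⁻¹' F)ᶜ)) := isClosed_closure.preimage hψc
    have : ({0}ᶜ : Set ℂ) ⊆ ψ ⁻¹' closure (φ '' (φ ⁻¹' F)ᶜ) := by
      intro s hs
      rw [Set.mem_preimage, hψφ s hs]; exact hcl _
    have h2 := closure_minimal this hcl2
    rw [(dense_compl_singleton (0 : ℂ)).closure_eq] at h2
    exact h2 (Set.mem_univ 0)
  · rw [hsurj p hp hpd]; exact hcl _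


/-- Elements of `ℤ[ζ₅]` in the basis `1, ζ, ζ², ζ³`. -/
@[ext] structure Z5 where
  a : ℤ
  b : ℤ
  c : ℤ
  d : ℤ

instance : DecidableEq Z5 := fun x y =>
  decidable_of_iff (x.a = y.a ∧ x.b = y.b ∧ x.c = y.c ∧ x.d = y.d)
    ⟨fun h => Z5.ext h.1 h.2.1 h.2.2.1 h.2.2.2, fun h => by subst h; simp⟩

def Z5.add (x y : Z5) : Z5 := ⟨x.a + y.a, x.b + y.b, x.c + y.c, x.d + y.d⟩

def Z5.sub (x y : Z5) : Z5 := ⟨x.a - y.a, x.b - y.b, x.c - y.c, x.d - y.d⟩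

def Z5.mul (x y : Z5) : Z5 :=
  let t := x.b * y.d + x.c * y.c + x.d * y.b
  ⟨x.a * y.a - t + (x.c * y.d + x.d * y.c), x.a * y.b + x.b * y.a - t + x.d * y.d,
    x.a * y.c + x.b * y.b + x.c * y.a - t, x.a * y.d + x.b * y.c + x.c * y.b + x.d * y.a - t⟩

def Z5.ev (α : ℂ) (x : Z5) : ℂ := x.a + x.b * α + x.c * α ^ 2 + x.d * α ^ 3

/-- The condition on the root. -/
def Cyc (α : ℂ) : Prop := α ^ 4 + α ^ 3 + α ^ 2 + α + 1 = 0

lemma Z5.ev_add (α : ℂ) (x y : Z5) : (x.add y).ev α = x.ev α + y.ev α := by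
  simp [Z5.ev, Z5.add]; ring

lemma Z5.ev_sub (α : ℂ) (x y : Z5) : (x.sub y).ev α = x.ev α - y.ev α := by
  simp [Z5.ev, Z5.sub]; ring

lemma Z5.ev_mul {α : ℂ} (h : Cyc α) (x y : Z5) : (x.mul y).ev α = x.ev α * y.ev α := by
  unfold Cyc at h
  simp only [Z5.ev, Z5.mul]
  push_cast
  linear_combination (-((x.b : ℂ) * y.d + x.c * y.c + x.d * y.b)
    - (α - 1) * (x.c * y.d + x.d * y.c) - (α ^ 2 - α) * (x.d * y.d)) * h

lemma Cyc.prim {α : ℂ} (h : Cyc α) : IsPrimitiveRoot α 5 := by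
  have h5 : α ^ 5 = 1 := by
    unfold Cyc at h
    linear_combination (α - 1) * h
  have h1 : α ≠ 1 := by
    rintro rfl
    unfold Cyc at h
    norm_num at h
  have := orderOf_eq_prime (p := 5) (hp := ⟨by norm_num⟩) h5 h1
  rw [← this]
  exact IsPrimitiveRoot.orderOf α

lemma Cyc.five {α : ℂ} (h : Cyc α) : α ^ 5 = 1 := h.prim.pow_eq_one

lemma Z5.ev_eq_zero {α : ℂ} (h : Cyc α) (x : Z5) : x.ev α = 0 ↔ x = ⟨0, 0, 0, 0⟩ := by
  constructor
  · intro hx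
    have hp := h.prim
    set P : Polynomial ℤ := Polynomial.C x.a + Polynomial.C x.b * Polynomial.X
      + Polynomial.C x.c * Polynomial.X ^ 2 + Polynomial.C x.d * Polynomial.X ^ 3 with hP
    have h0 : Polynomial.aeval α P = 0 := by
      rw [hP]; simp only [map_add, map_mul, map_pow, Polynomial.aeval_X, Polynomial.aeval_C]
      simpa [Z5.ev] using hx
    have hdvd : minpoly ℤ α ∣ P :=
      minpoly.isIntegrallyClosed_dvd (hp.isIntegral (by norm_num)) h0
    have hdeg : (minpoly ℤ α).natDegree = 4 := by
      rw [← Polynomial.cyclotomic_eq_minpoly hp (by norm_num), Polynomial.natDegree_cyclotomic]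
      decide
    have hPdeg : P.natDegree ≤ 3 := by
      rw [hP]; compute_degree
    have hP0 : P = 0 := by
      by_contra hne
      have := Polynomial.natDegree_le_of_dvd hdvd hne
      omega
    have c0 : P.coeff 0 = x.a := by
      simp [hP, Polynomial.coeff_X, Polynomial.coeff_X_pow]
    have c1 : P.coeff 1 = x.b := by
      simp only [hP, Polynomial.coeff_add, Polynomial.coeff_C_mul, Polynomial.coeff_X,
        Polynomial.coeff_X_pow, Polynomial.coeff_C]
      norm_num
    have c2 : P.coeff 2 = x.c := by
      simp only [hP, Polynomial.coeff_add, Polynomial.coeff_C_mul, Polynomial.coeff_X,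
        Polynomial.coeff_X_pow, Polynomial.coeff_C]
      norm_num
    have c3 : P.coeff 3 = x.d := by
      simp only [hP, Polynomial.coeff_add, Polynomial.coeff_C_mul, Polynomial.coeff_X,
        Polynomial.coeff_X_pow, Polynomial.coeff_C]
      norm_num
    rw [hP0, Polynomial.coeff_zero] at c0 c1 c2 c3
    ext <;> simp [← c0, ← c1, ← c2, ← c3]
  · rintro rfl
    simp [Z5.ev]

/-- Coefficients of the arrangement in `ℤ[ζ₅]`. -/
def cz : Fin 11 → Fin 3 → Z5 :=
  ![![⟨0,0,0,0⟩, ⟨0,0,0,0⟩, ⟨1,0,0,0⟩],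
    ![⟨1,0,0,0⟩, ⟨0,0,0,0⟩, ⟨0,0,0,0⟩],
    ![⟨1,0,0,0⟩, ⟨0,0,0,0⟩, ⟨-1,0,0,0⟩],
    ![⟨1,0,0,0⟩, ⟨0,0,-1,-1⟩, ⟨0,0,0,0⟩],
    ![⟨0,0,0,0⟩, ⟨1,0,0,0⟩, ⟨0,0,0,0⟩],
    ![⟨0,1,0,0⟩, ⟨1,0,0,0⟩, ⟨0,0,0,0⟩],
    ![⟨0,0,0,0⟩, ⟨1,0,0,0⟩, ⟨-1,0,0,0⟩],
    ![⟨0,0,0,0⟩, ⟨-1,-1,-1,-1⟩, ⟨1,0,0,0⟩],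
    ![⟨0,0,1,0⟩, ⟨0,1,0,0⟩, ⟨1,0,0,0⟩],
    ![⟨0,0,-1,0⟩, ⟨1,0,0,0⟩, ⟨-1,-1,-1,-1⟩],
    ![⟨0,0,1,0⟩, ⟨-1,0,0,0⟩, ⟨1,0,0,0⟩]]

/-- Coefficients of the arrangement. -/
def cf (α : ℂ) (k : Fin 11) (i : Fin 3) : ℂ := (cz k i).ev α

lemma B2line_eq (α : ℂ) (k : Fin 11) : B2line α k = PL (cf α k) := by
  fin_cases k <;> simp [B2line, PL, cf, cz, Z5.ev] <;> congr 1 <;> ring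

def dz (c d e : Fin 3 → Z5) : Z5 :=
  (((c 0).mul (((d 1).mul (e 2)).sub ((d 2).mul (e 1)))).add
    ((c 1).mul (((d 2).mul (e 0)).sub ((d 0).mul (e 2))))).add
    ((c 2).mul (((d 0).mul (e 1)).sub ((d 1).mul (e 0))))

lemma dz_ev {α : ℂ} (h : Cyc α) (k l m : Fin 11) :
    dt (cf α k) (cf α l) (cf α m) = (dz (cz k) (cz l) (cz m)).ev α := by
  simp only [dz, Z5.ev_add, Z5.ev_mul h, Z5.ev_sub, dt, cf]

/-- The concurrency table. -/
def blocks : List (List ℕ) := [[0,1,2],[0,4,6,7],[0,5,8],[0,9,10],[1,3,4,5],[1,6,10],[1,8,9],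
  [2,3,8],[2,5,7],[3,6,9],[3,7,10],[4,8,10]]

def tb (k l m : Fin 11) : Bool :=
  k == l || k == m || l == m ||
    blocks.any (fun b => b.contains k.1 && b.contains l.1 && b.contains m.1)

lemma tb_dz : ∀ k l m : Fin 11, tb k l m = decide (dz (cz k) (cz l) (cz m) = ⟨0,0,0,0⟩) := by
  decide +kernel

lemma dt_tb {α : ℂ} (h : Cyc α) (k l m : Fin 11) :
    dt (cf α k) (cf α l) (cf α m) = 0 ↔ tb k l m = true := by
  rw [dz_ev h, Z5.ev_eq_zero h, tb_dz]; simp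

lemma dt_ne {α : ℂ} (h : Cyc α) {k l m : Fin 11} (hk : tb k l m = false) :
    dt (cf α k) (cf α l) (cf α m) ≠ 0 := by
  rw [Ne, dt_tb h, hk]; simp

def WW (w : Fin 11 → ℕ) (k : Fin 11) : ℕ :=
  ∑ a, ∑ b, if tb k a b then w a * w b else 0

lemma WW_inv (σ : Fin 11 ≃ Fin 11) (hσ : ∀ k l m, tb (σ k) (σ l) (σ m) = tb k l m)
    (w : Fin 11 → ℕ) (hw : ∀ k, w (σ k) = w k) (k : Fin 11) : WW w (σ k) = WW w k := by
  unfold WW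
  rw [← Equiv.sum_comp σ]
  refine Finset.sum_congr rfl fun a _ => ?_
  rw [← Equiv.sum_comp σ]
  refine Finset.sum_congr rfl fun b _ => ?_
  rw [hσ, hw, hw]

def w1 : Fin 11 → ℕ := ![43,43,37,43,45,41,41,41,39,37,39]

def w2 : Fin 11 → ℕ :=
  ![73319,73663,59297,73515,78961,69677,69473,69325,63775,59117,64119]

lemma WW1 : ∀ k, WW (fun _ => 1) k = w1 k := by decide +kernel

lemma WW2 : ∀ k, WW w1 k = w2 k := by decide +kernel

lemma w2_inj : ∀ k l, w2 k = w2 l → k = l := by decide +kernel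

lemma perm_triv (σ : Fin 11 ≃ Fin 11) (hσ : ∀ k l m, tb (σ k) (σ l) (σ m) = tb k l m)
    (k : Fin 11) : σ k = k := by
  have h1 : ∀ k, w1 (σ k) = w1 k := by
    intro k
    rw [← WW1, ← WW1]
    exact WW_inv σ hσ _ (fun _ => rfl) k
  apply w2_inj
  rw [← WW2, ← WW2]
  exact WW_inv σ hσ _ h1 k

lemma tb_pair : ∀ k l : Fin 11, k ≠ l → ∃ m, tb k l m = false := by decide +kernel

lemma exists_common {c d e : Fin 3 → ℂ} (h : dt c d e = 0) : ∃ p, p ∈ PL c ∧ p ∈ PL d ∧ p ∈ PL e := by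
  have : (Matrix.of ![c, d, e]).det = 0 := by
    rw [← h, Matrix.det_fin_three]
    simp [dt]; ring
  obtain ⟨v, hv, hv0⟩ := Matrix.exists_mulVec_eq_zero_iff.2 this
  refine ⟨Projectivization.mk ℂ v hv, ?_, ?_, ?_⟩ <;> rw [mem_PL]
  · have := congrFun hv0 0
    simpa [Matrix.mulVec, dotProduct, Fin.sum_univ_three, lf] using this
  · have := congrFun hv0 1
    simpa [Matrix.mulVec, dotProduct, Fin.sum_univ_three, lf] using this
  · have := congrFun hv0 2
    simpa [Matrix.mulVec, dotProduct, Fin.sum_univ_three, lf] using this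

lemma no_common {c d e : Fin 3 → ℂ} (h : dt c d e ≠ 0) (p : CP2) (h1 : p ∈ PL c) (h2 : p ∈ PL d)
    (h3 : p ∈ PL e) : False := by
  induction p using Projectivization.ind with
  | h v hv =>
    rw [mem_PL] at h1 h2 h3
    have := sol_lf h v
    rw [h1, h2, h3, sol_zero] at this
    exact hv this.symm


lemma line_map {c c' : Fin 11 → Fin 3 → ℂ} (hc : ∀ k l, k ≠ l → ∃ m, dt (c k) (c l) (c m) ≠ 0)
    (hc' : ∀ k l, k ≠ l → ∃ m, dt (c' k) (c' l) (c' m) ≠ 0) (h : CP2 ≃ₜ CP2)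
    (hh : ∀ p k, p ∈ PL (c k) → ∃ m, h p ∈ PL (c' m)) (k : Fin 11) :
    ∃ m, ∀ p ∈ PL (c k), h p ∈ PL (c' m) := by
  obtain ⟨l, hl⟩ : ∃ l : Fin 11, k ≠ l := ⟨k + 1, by revert k; decide⟩
  obtain ⟨e, he⟩ := hc k l hl
  set Sg : Set CP2 := ⋃ m, ⋃ n, ⋃ (_ : m ≠ n), PL (c' m) ∩ PL (c' n) with hSg
  have hfin : Sg.Finite := by
    apply Set.finite_iUnion; intro m
    apply Set.finite_iUnion; intro n
    apply Set.finite_iUnion; intro hmn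
    obtain ⟨e, he⟩ := hc' m n hmn
    exact (inter_subsingleton he).finite
  have hfin2 : (h ⁻¹' Sg).Finite := hfin.preimage h.injective.injOn
  obtain ⟨hpre, hcl⟩ := line_param he (h ⁻¹' Sg) hfin2
  set S := PL (c k) \ (PL (c l) ∪ h ⁻¹' Sg) with hS
  have hne : S.Nonempty := by
    obtain ⟨p, hp, -⟩ := exists_common (c := c k) (d := c k) (e := c k) (by unfold dt; ring)
    have := hcl hp
    exact closure_nonempty_iff.1 ⟨p, this⟩
  obtain ⟨p0, hp0⟩ := hne
  obtain ⟨m, hm⟩ := hh p0 k hp0.1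
  refine ⟨m, ?_⟩
  have hA : IsClosed (h ⁻¹' PL (c' m)) := (PL_closed _).preimage h.continuous
  have hB : IsClosed (⋃ n, ⋃ (_ : m ≠ n), h ⁻¹' PL (c' n)) := by
    apply isClosed_iUnion_of_finite; intro n
    apply isClosed_iUnion_of_finite; intro _
    exact (PL_closed _).preimage h.continuous
  have hsub : S ⊆ h ⁻¹' PL (c' m) := by
    by_contra hcon
    obtain ⟨q, hq, hq2⟩ := Set.not_subset.1 hcon
    have hcov : S ⊆ h ⁻¹' PL (c' m) ∪ (⋃ n, ⋃ (_ : m ≠ n), h ⁻¹' PL (c' n)) := by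
      intro p hp
      obtain ⟨n, hn⟩ := hh p k hp.1
      by_cases hmn : m = n
      · left; rw [hmn]; exact hn
      · right; simp only [Set.mem_iUnion]; exact ⟨n, hmn, hn⟩
    have hqB : q ∈ (⋃ n, ⋃ (_ : m ≠ n), h ⁻¹' PL (c' n)) := (hcov hq).resolve_left hq2
    obtain ⟨r, hrS, hrA, hrB⟩ := isPreconnected_closed_iff.1 hpre _ _ hA hB hcov
      ⟨p0, hp0, hm⟩ ⟨q, hq, hqB⟩
    simp only [Set.mem_iUnion] at hrB
    obtain ⟨n, hmn, hn⟩ := hrB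
    apply hrS.2
    right
    simp only [hSg, Set.mem_preimage, Set.mem_iUnion]
    exact ⟨m, n, hmn, hrA, hn⟩
  intro p hp
  exact closure_minimal hsub hA (hcl hp)

lemma not_sub {c d e : Fin 3 → ℂ} (h : dt c d e ≠ 0) : ∃ p, p ∈ PL c ∧ p ∉ PL d := by
  have hne : sol c d e 0 1 0 ≠ 0 := by
    intro hx
    have := lf_sol2 h 0 1 0
    rw [hx, lf_zero] at this
    exact zero_ne_one this
  refine ⟨Projectivization.mk ℂ _ hne, ?_, ?_⟩
  · rw [mem_PL, lf_sol1 h]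
  · rw [mem_PL, lf_sol2 h]; exact one_ne_zero

lemma lines_fixed {α β : ℂ} (hα : Cyc α) (hβ : Cyc β) (h : CP2 ≃ₜ CP2)
    (hh : h '' (⋃ k, PL (cf α k)) = ⋃ k, PL (cf β k)) (k : Fin 11) (p : CP2) :
    h p ∈ PL (cf β k) ↔ p ∈ PL (cf α k) := by
  have pair : ∀ α : ℂ, Cyc α → ∀ k l, k ≠ l → ∃ m, dt (cf α k) (cf α l) (cf α m) ≠ 0 := by
    intro α hα k l hkl
    obtain ⟨m, hm⟩ := tb_pair k l hkl
    exact ⟨m, dt_ne hα hm⟩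
  have m1 : ∀ p k, p ∈ PL (cf α k) → ∃ m, h p ∈ PL (cf β m) := by
    intro p k hp
    have : h p ∈ ⋃ k, PL (cf β k) := by
      rw [← hh]; exact ⟨p, Set.mem_iUnion.2 ⟨k, hp⟩, rfl⟩
    exact Set.mem_iUnion.1 this
  have m2 : ∀ p k, p ∈ PL (cf β k) → ∃ m, h.symm p ∈ PL (cf α m) := by
    intro p k hp
    have : p ∈ h '' ⋃ k, PL (cf α k) := by
      rw [hh]; exact Set.mem_iUnion.2 ⟨k, hp⟩
    obtain ⟨q, hq, rfl⟩ := this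
    rw [h.symm_apply_apply]
    exact Set.mem_iUnion.1 hq
  choose s hs using line_map (pair α hα) (pair β hβ) h m1
  choose t ht using line_map (pair β hβ) (pair α hα) h.symm m2
  have inj : ∀ α : ℂ, Cyc α → ∀ k l, (∀ p ∈ PL (cf α k), p ∈ PL (cf α l)) → k = l := by
    intro α hα k l hkl
    by_contra hne
    obtain ⟨m, hm⟩ := pair α hα k l hne
    obtain ⟨p, hp1, hp2⟩ := not_sub hm
    exact hp2 (hkl p hp1)
  have ts : ∀ k, t (s k) = k := by
    intro k
    refine (inj α hα k _ fun p hp => ?_).symm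
    have := ht _ _ (hs k p hp)
    rwa [h.symm_apply_apply] at this
  have st : ∀ k, s (t k) = k := by
    intro k
    refine (inj β hβ k _ fun p hp => ?_).symm
    have := hs _ _ (ht k p hp)
    rwa [h.apply_symm_apply] at this
  have hiff : ∀ k p, h p ∈ PL (cf β (s k)) ↔ p ∈ PL (cf α k) := by
    intro k p
    refine ⟨fun hp => ?_, hs k p⟩
    have := ht _ _ hp
    rwa [h.symm_apply_apply, ts] at this
  have common : ∀ α : ℂ, Cyc α → ∀ k l m, tb k l m = true ↔
      ∃ p, p ∈ PL (cf α k) ∧ p ∈ PL (cf α l) ∧ p ∈ PL (cf α m) := by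
    intro α hα k l m
    rw [← dt_tb hα]
    constructor
    · exact exists_common
    · rintro ⟨p, h1, h2, h3⟩
      by_contra hne
      exact no_common hne p h1 h2 h3
  let σ : Fin 11 ≃ Fin 11 := ⟨s, t, ts, st⟩
  have hσ : ∀ k l m, tb (σ k) (σ l) (σ m) = tb k l m := by
    intro k l m
    rw [Bool.eq_iff_iff, common β hβ, common α hα]
    constructor
    · rintro ⟨p, h1, h2, h3⟩
      refine ⟨h.symm p, ?_, ?_, ?_⟩ <;> rw [← hiff, h.apply_symm_apply] <;> assumption
    · rintro ⟨p, h1, h2, h3⟩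
      exact ⟨h p, (hiff _ _).2 h1, (hiff _ _).2 h2, (hiff _ _).2 h3⟩
  have hk : s k = k := perm_triv σ hσ k
  have := hiff k p
  rwa [hk] at this


def ss : Fin 6 → Fin 11 := ![2, 3, 4, 5, 6, 10]

/-- The basic ratios. -/
def rr (α : ℂ) (i : Fin 6) (p : CP2) : ℂ := rt (cf α (ss i)) (cf α 0) p

/-- Complement of seven lines. -/
def NN (α : ℂ) : Set CP2 := {p | p ∉ PL (cf α 0) ∧ ∀ i, p ∉ PL (cf α (ss i))}

lemma rr_ne {α : ℂ} {p : CP2} (hp : p ∈ NN α) (i : Fin 6) : rr α i p ≠ 0 :=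
  rt_ne (hp.2 i) hp.1

/-- Affine coordinates. -/
lemma affine {α : ℂ} {p : CP2} (hp : p ∉ PL (cf α 0)) :
    ∃ x y : ℂ, (∀ k, (p ∈ PL (cf α k) ↔ cf α k 0 * x + cf α k 1 * y + cf α k 2 = 0) ∧
      rt (cf α k) (cf α 0) p = cf α k 0 * x + cf α k 1 * y + cf α k 2) := by
  have hz : p.rep 2 ≠ 0 := by
    intro h0; apply hp
    change cf α 0 0 * p.rep 0 + cf α 0 1 * p.rep 1 + cf α 0 2 * p.rep 2 = 0
    simp [cf, cz, Z5.ev, h0]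
  have h0 : lf (cf α 0) p.rep = p.rep 2 := by simp [lf, cf, cz, Z5.ev]
  refine ⟨p.rep 0 / p.rep 2, p.rep 1 / p.rep 2, fun k => ?_⟩
  have e : rt (cf α k) (cf α 0) p =
      cf α k 0 * (p.rep 0 / p.rep 2) + cf α k 1 * (p.rep 1 / p.rep 2) + cf α k 2 := by
    rw [rt, h0, lf]; field_simp
  refine ⟨?_, e⟩
  rw [← e, rt, h0, div_eq_zero_iff]
  simp only [hz, or_false]
  exact Iff.rfl

lemma mono_const {α β : ℂ} (hα : Cyc α) (h : CP2 ≃ₜ CP2)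
    (hh : ∀ k p, h p ∈ PL (cf β k) ↔ p ∈ PL (cf α k)) (n : ℤ) (g : Fin 6 → CP2 → ℂ)
    (hg : ∀ i, ContinuousOn (g i) (PL (cf α (ss i)) ∪ PL (cf α 0))ᶜ)
    (hr : ∀ i, ∀ p ∈ (PL (cf α (ss i)) ∪ PL (cf α 0))ᶜ,
      rr β i (h p) = rr α i p ^ n * Complex.exp (g i p))
    (m : Fin 11) (hm : m = 1 ∨ m = 7 ∨ m = 8 ∨ m = 9) (e : Fin 6 → ℤ) (K K' : ℂ)
    (hK : ∀ p ∈ NN α, p ∈ PL (cf α m) → ∏ i, rr α i p ^ e i = K)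
    (hK' : ∀ p ∈ NN β, p ∈ PL (cf β m) → ∏ i, rr β i p ^ e i = K')
    (p q : CP2) (hp : p ∈ NN α) (hq : q ∈ NN α) (hpm : p ∈ PL (cf α m)) (hqm : q ∈ PL (cf α m)) :
    ∑ i, e i * g i p = ∑ i, e i * g i q := by
  have tm : ∀ m : Fin 11, (m = 1 ∨ m = 7 ∨ m = 8 ∨ m = 9) →
      (∃ k, tb m 0 k = false) ∧ ∀ i, ∃ k, tb m (ss i) k = false := by decide +kernel
  obtain ⟨⟨k0, hk0⟩, hkk⟩ := tm m hm
  have hfin : (⋃ i, PL (cf α m) ∩ PL (cf α (ss i))).Finite := by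
    apply Set.finite_iUnion; intro i
    obtain ⟨k, hk⟩ := hkk i
    exact (inter_subsingleton (dt_ne hα hk)).finite
  obtain ⟨hpre, -⟩ := line_param (dt_ne hα hk0) _ hfin
  set S := PL (cf α m) \ (PL (cf α 0) ∪ ⋃ i, PL (cf α m) ∩ PL (cf α (ss i))) with hS
  have hSi : ∀ p, p ∈ S ↔ p ∈ NN α ∧ p ∈ PL (cf α m) := by
    intro p
    constructor
    · rintro ⟨h1, h2⟩
      exact ⟨⟨fun h3 => h2 (Or.inl h3), fun i h3 => h2 (Or.inr (Set.mem_iUnion.2 ⟨i, h1, h3⟩))⟩, h1⟩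
    · rintro ⟨h1, h2⟩
      refine ⟨h2, ?_⟩
      rintro (h3 | h3)
      · exact h1.1 h3
      · obtain ⟨i, -, h4⟩ := Set.mem_iUnion.1 h3
        exact h1.2 i h4
  have hNi : ∀ p ∈ NN α, ∀ i, p ∈ (PL (cf α (ss i)) ∪ PL (cf α 0))ᶜ := by
    rintro p hp i (h1 | h1)
    · exact hp.2 i h1
    · exact hp.1 h1
  refine const_of_exp hpre (f := fun p => ∑ i, (e i : ℂ) * g i p) ?_ (c := K' / K ^ n) ?_
    ((hSi p).2 ⟨hp, hpm⟩) ((hSi q).2 ⟨hq, hqm⟩)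
  · apply continuousOn_finsetSum
    intro i _
    exact continuousOn_const.mul ((hg i).mono fun p hp => hNi p ((hSi p).1 hp).1 i)
  · intro x hx
    obtain ⟨hxN, hxm⟩ := (hSi x).1 hx
    have hK1 := hK x hxN hxm
    have hxN' : h x ∈ NN β := ⟨by rw [hh]; exact hxN.1, fun i => by rw [hh]; exact hxN.2 i⟩
    have hK2 := hK' (h x) hxN' (by rw [hh]; exact hxm)
    have hKne : K ≠ 0 := by
      rw [← hK1]
      exact Finset.prod_ne_zero_iff.2 fun i _ => zpow_ne_zero _ (rr_ne hxN i)
    rw [eq_div_iff (zpow_ne_zero _ hKne), ← hK2, ← hK1, Complex.exp_sum, ← Finset.prod_zpow,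
      ← Finset.prod_mul_distrib]
    refine Finset.prod_congr rfl fun i _ => ?_
    rw [hr i x (hNi x hxN i), mul_zpow, Complex.exp_int_mul, mul_comm, ← zpow_mul, ← zpow_mul,
      mul_comm n]

lemma coords {α : ℂ} {p : CP2} (hp : p ∈ NN α) : ∃ x y : ℂ,
    (x - 1 ≠ 0 ∧ x - (α ^ 3 + α ^ 2) * y ≠ 0 ∧ y ≠ 0 ∧ α * x + y ≠ 0 ∧ y - 1 ≠ 0 ∧
      α ^ 2 * x - y + 1 ≠ 0) ∧
    (rr α 0 p = x - 1 ∧ rr α 1 p = x - (α ^ 3 + α ^ 2) * y ∧ rr α 2 p = y ∧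
      rr α 3 p = α * x + y ∧ rr α 4 p = y - 1 ∧ rr α 5 p = α ^ 2 * x - y + 1) ∧
    (p ∈ PL (cf α 1) → x = 0) ∧ (p ∈ PL (cf α 7) → (-α ^ 3 - α ^ 2 - α - 1) * y + 1 = 0) ∧
    (p ∈ PL (cf α 8) → α ^ 2 * x + α * y + 1 = 0) ∧
    (p ∈ PL (cf α 9) → -α ^ 2 * x + y + (-α ^ 3 - α ^ 2 - α - 1) = 0) := by
  obtain ⟨x, y, hxy⟩ := affine hp.1
  refine ⟨x, y, ?_⟩
  have e0 : rr α 0 p = x - 1 := by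
    rw [rr, (hxy _).2]; simp [cf, cz, ss, Z5.ev]; ring
  have e1 : rr α 1 p = x - (α ^ 3 + α ^ 2) * y := by
    rw [rr, (hxy _).2]; simp [cf, cz, ss, Z5.ev]; ring
  have e2 : rr α 2 p = y := by
    rw [rr, (hxy _).2]; simp [cf, cz, ss, Z5.ev]
  have e3 : rr α 3 p = α * x + y := by
    rw [rr, (hxy _).2]; simp [cf, cz, ss, Z5.ev]
  have e4 : rr α 4 p = y - 1 := by
    rw [rr, (hxy _).2]; simp [cf, cz, ss, Z5.ev]; ring
  have e5 : rr α 5 p = α ^ 2 * x - y + 1 := by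
    rw [rr, (hxy _).2]; simp [cf, cz, ss, Z5.ev]; ring
  refine ⟨⟨?_, ?_, ?_, ?_, ?_, ?_⟩, ⟨e0, e1, e2, e3, e4, e5⟩, ?_, ?_, ?_, ?_⟩
  · rw [← e0]; exact rr_ne hp 0
  · rw [← e1]; exact rr_ne hp 1
  · rw [← e2]; exact rr_ne hp 2
  · rw [← e3]; exact rr_ne hp 3
  · rw [← e4]; exact rr_ne hp 4
  · rw [← e5]; exact rr_ne hp 5
  · rw [(hxy 1).1]; intro hh
    simpa [cf, cz, Z5.ev] using hh
  · rw [(hxy 7).1]; intro hh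
    have q0 : cf α 7 0 = 0 := by simp [cf, cz, Z5.ev]
    have q1 : cf α 7 1 = -α ^ 3 - α ^ 2 - α - 1 := by simp [cf, cz, Z5.ev]; ring
    have q2 : cf α 7 2 = 1 := by simp [cf, cz, Z5.ev]
    rw [q0, q1, q2] at hh
    linear_combination hh
  · rw [(hxy 8).1]; intro hh; rw [← hh]
    simp [cf, cz, Z5.ev]
  · rw [(hxy 9).1]; intro hh; rw [← hh]
    simp [cf, cz, Z5.ev]; ring

def eb : Fin 6 → ℤ := ![1, -1, -1, -1, 0, 1]
def ec : Fin 6 → ℤ := ![0, 1, 0, 0, -1, -1]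
def ea : Fin 6 → ℤ := ![-2, 1, -3, 2, 1, -1]

lemma Cyc.ne {α : ℂ} (h : Cyc α) : α ≠ 0 := by
  rintro rfl; unfold Cyc at h; norm_num at h

lemma prod_eb (f : Fin 6 → ℂ) : ∏ i, f i ^ eb i = f 0 * f 5 / (f 1 * f 2 * f 3) := by
  rw [Fin.prod_univ_six]; simp [eb]; ring

lemma prod_ec (f : Fin 6 → ℂ) : ∏ i, f i ^ ec i = f 1 / (f 4 * f 5) := by
  rw [Fin.prod_univ_six]; simp [ec]; ring

lemma prod_ea (f : Fin 6 → ℂ) :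
    ∏ i, f i ^ ea i = f 1 * f 3 ^ 2 * f 4 / (f 0 ^ 2 * f 2 ^ 3 * f 5) := by
  rw [Fin.prod_univ_six]; simp [ea]
  rw [div_eq_mul_inv, mul_inv, mul_inv]; ring

lemma kb9 {α : ℂ} (hα : Cyc α) (p : CP2) (hp : p ∈ NN α) (hm : p ∈ PL (cf α 8)) :
    ∏ i, rr α i p ^ eb i = -1 := by
  obtain ⟨x, y, ⟨n0, n1, n2, n3, n4, n5⟩, ⟨e0, e1, e2, e3, e4, e5⟩, -, -, h9, -⟩ := coords hp
  have h := h9 hm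
  have h5 := hα.five
  have hc : α ^ 4 + α ^ 3 + α ^ 2 + α + 1 = 0 := hα
  rw [prod_eb, e0, e1, e2, e3, e5, div_eq_iff (by positivity)]
  have a1 : α * x + y = -α ^ 4 := by linear_combination α ^ 4 * h - (α * x + y) * h5
  have a2 : α ^ 2 * x - y + 1 = -(1 + α) * y := by linear_combination h
  have a3 : x - (α ^ 3 + α ^ 2) * y = -(α + α ^ 2) * (x - 1) := by
    linear_combination -(α ^ 2 + α) * h + x * hc
  rw [a1, a2, a3]
  linear_combination (x - 1) * y * (1 + α) * h5

lemma y8 {α y : ℂ} (hα : Cyc α) (h : (-α ^ 3 - α ^ 2 - α - 1) * y + 1 = 0) : y = -α := by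
  have h5 := hα.five
  have hc : α ^ 4 + α ^ 3 + α ^ 2 + α + 1 = 0 := hα
  linear_combination α * h + α * y * hc - y * h5

lemma kb8 {α : ℂ} (hα : Cyc α) (p : CP2) (hp : p ∈ NN α) (hm : p ∈ PL (cf α 7)) :
    ∏ i, rr α i p ^ eb i = -1 := by
  obtain ⟨x, y, ⟨n0, n1, n2, n3, n4, n5⟩, ⟨e0, e1, e2, e3, e4, e5⟩, -, h8, -, -⟩ := coords hp
  have h := y8 hα (h8 hm)
  have h5 := hα.five
  rw [prod_eb, e0, e1, e2, e3, e5, div_eq_iff (by positivity)]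
  subst h
  linear_combination (x - 1) * (-α - 1) * h5

lemma kc8 {α : ℂ} (hα : Cyc α) (p : CP2) (hp : p ∈ NN α) (hm : p ∈ PL (cf α 7)) :
    ∏ i, rr α i p ^ ec i = 1 / (α ^ 2 * (-α - 1)) := by
  obtain ⟨x, y, ⟨n0, n1, n2, n3, n4, n5⟩, ⟨e0, e1, e2, e3, e4, e5⟩, -, h8, -, -⟩ := coords hp
  have h := y8 hα (h8 hm)
  have h5 := hα.five
  have h0 := hα.ne
  subst h
  rw [prod_ec, e1, e4, e5, div_eq_div_iff (by positivity) (by positivity)]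
  linear_combination (-α - 1) * (α + 1) * h5

lemma kc10 {α : ℂ} (hα : Cyc α) (p : CP2) (hp : p ∈ NN α) (hm : p ∈ PL (cf α 9)) :
    ∏ i, rr α i p ^ ec i = -α ^ 2 / (α ^ 4 + 1) := by
  obtain ⟨x, y, ⟨n0, n1, n2, n3, n4, n5⟩, ⟨e0, e1, e2, e3, e4, e5⟩, -, -, -, h10⟩ := coords hp
  have h := h10 hm
  have h5 := hα.five
  have hc : α ^ 4 + α ^ 3 + α ^ 2 + α + 1 = 0 := hα
  have a1 : α ^ 2 * x - y + 1 = α ^ 4 + 1 := by linear_combination -h - hc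
  have a2 : x - (α ^ 3 + α ^ 2) * y = -α ^ 2 * (y - 1) := by
    linear_combination -α ^ 3 * h - x * h5 + α ^ 2 * h5 - α ^ 3 * hc
  rw [a1] at n5
  rw [prod_ec, e1, e4, e5, a1, a2, div_eq_div_iff (by positivity) (by positivity)]
  ring

lemma ka2 {α : ℂ} (p : CP2) (hp : p ∈ NN α) (hm : p ∈ PL (cf α 1)) :
    ∏ i, rr α i p ^ ea i = α ^ 3 + α ^ 2 := by
  obtain ⟨x, y, ⟨n0, n1, n2, n3, n4, n5⟩, ⟨e0, e1, e2, e3, e4, e5⟩, h2, -, -, -⟩ := coords hp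
  have h := h2 hm
  subst h
  rw [prod_ea, e0, e1, e2, e3, e4, e5, div_eq_iff (by positivity)]
  ring

/-- The points `O, P2, P9, P10`. -/
def pz : Fin 4 → Fin 3 → Z5 :=
  ![![⟨0,0,0,0⟩, ⟨1,1,1,1⟩, ⟨1,0,0,0⟩],
    ![⟨0,0,0,0⟩, ⟨0,-1,0,0⟩, ⟨1,0,0,0⟩],
    ![⟨1,0,0,-1⟩, ⟨0,-1,0,0⟩, ⟨1,0,0,0⟩],
    ![⟨1,1,2,1⟩, ⟨0,-1,0,0⟩, ⟨1,0,0,0⟩]]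

def pv (α : ℂ) (a : Fin 4) (i : Fin 3) : ℂ := (pz a i).ev α

lemma pv_ne (α : ℂ) (a : Fin 4) : pv α a ≠ 0 := by
  intro h
  have := congrFun h 2
  fin_cases a <;> simp [pv, pz, Z5.ev] at this

def pp (α : ℂ) (a : Fin 4) : CP2 := Projectivization.mk ℂ (pv α a) (pv_ne α a)

def lz (c v : Fin 3 → Z5) : Z5 := (((c 0).mul (v 0)).add ((c 1).mul (v 1))).add ((c 2).mul (v 2))

def zz : Z5 := ⟨0, 0, 0, 0⟩

lemma pp_mem {α : ℂ} (hα : Cyc α) (a : Fin 4) (k : Fin 11) :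
    pp α a ∈ PL (cf α k) ↔ lz (cz k) (pz a) = zz := by
  rw [pp, mem_PL, zz, ← Z5.ev_eq_zero hα]
  simp only [lf, lz, Z5.ev_add, Z5.ev_mul hα, cf, pv]

lemma pp_NN {α : ℂ} (hα : Cyc α) (a : Fin 4) : pp α a ∈ NN α := by
  have h : ∀ a, lz (cz 0) (pz a) ≠ zz ∧ ∀ i, lz (cz (ss i)) (pz a) ≠ zz := by decide +kernel
  exact ⟨by rw [pp_mem hα]; exact (h a).1, fun i => by rw [pp_mem hα]; exact (h a).2 i⟩

lemma final {α β : ℂ} (hα : Cyc α) (hβ : Cyc β) (h : CP2 ≃ₜ CP2)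
    (hh : ∀ k p, h p ∈ PL (cf β k) ↔ p ∈ PL (cf α k)) : β ^ 3 = α ^ 3 ∨ β ^ 3 * α ^ 3 = 1 := by
  have t1 : ∀ i, ∃ e, tb (ss i) 0 e = false := by decide +kernel
  have ex : ∀ i, ∃ n : ℤ, (n = 1 ∨ n = -1) ∧ ∃ g : CP2 → ℂ,
      ContinuousOn g (PL (cf α (ss i)) ∪ PL (cf α 0))ᶜ ∧
      ∀ p ∈ (PL (cf α (ss i)) ∪ PL (cf α 0))ᶜ,
        rr β i (h p) = rr α i p ^ n * Complex.exp (g p) := by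
    intro i
    obtain ⟨e, he⟩ := t1 i
    exact pull (dt_ne hα he) (dt_ne hβ he) h (hh _) (hh _)
  choose n hn g hg hr using ex
  have t2 : ∀ i, i ≠ 0 → tb (ss i) 0 (ss 0) = false := by decide +kernel
  have hsame : ∀ i, n i = n 0 := by
    intro i
    by_cases hi : i = 0
    · rw [hi]
    · exact sign_eq (dt_ne hα (t2 i hi)) (dt_ne hβ (t2 i hi)) h (hh _) (hh _) (hh _) (hn i) (hn 0)
        (hg i) (hg 0) (hr i) (hr 0)
  simp only [hsame] at hr
  have hn0 := hn 0
  generalize n 0 = ε at hr hn0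
  have M := fun m hm e K K' hK hK' a b => mono_const hα h hh ε g hg hr m hm e K K' hK hK'
    (pp α a) (pp α b) (pp_NN hα a) (pp_NN hα b)
  have pm : ∀ {a : Fin 4} {k : Fin 11}, lz (cz k) (pz a) = zz → pp α a ∈ PL (cf α k) :=
    fun {a k} hz => (pp_mem hα a k).2 hz
  have b1 := M 8 (by decide) eb _ _ (kb9 hα) (kb9 hβ) 0 2 (pm (by decide)) (pm (by decide))
  have b2 := M 7 (by decide) eb _ _ (kb8 hα) (kb8 hβ) 2 1 (pm (by decide)) (pm (by decide))
  have c1 := M 9 (by decide) ec _ _ (kc10 hα) (kc10 hβ) 0 3 (pm (by decide)) (pm (by decide))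
  have c2 := M 7 (by decide) ec _ _ (kc8 hα) (kc8 hβ) 3 1 (pm (by decide)) (pm (by decide))
  have a1 := M 1 (by decide) ea _ _ ka2 ka2 0 1 (pm (by decide)) (pm (by decide))
  have b := b1.trans b2
  have c := c1.trans c2
  simp only [Fin.sum_univ_six, eb, ec, ea] at b c a1
  simp at b c a1
  have g5 : g 2 (pp α 0) = g 2 (pp α 1) := by
    linear_combination (-1 / 5) * (a1 + 2 * b + c)
  have fx : ∀ a k l m, lz (cz k) (pz a) = zz → lz (cz l) (pz a) = zz → tb k l m = false →
      h (pp α a) = pp β a := by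
    intro a k l m hk hl hm
    apply inter_subsingleton (dt_ne hβ hm)
    · exact ⟨(hh _ _).2 (pm hk), (hh _ _).2 (pm hl)⟩
    · exact ⟨(pp_mem hβ _ _).2 hk, (pp_mem hβ _ _).2 hl⟩
  have f0 := fx 0 1 8 0 (by decide) (by decide) (by decide)
  have f1 := fx 1 1 7 0 (by decide) (by decide) (by decide)
  have hmem : ∀ a, pp α a ∈ (PL (cf α (ss 2)) ∪ PL (cf α 0))ᶜ := by
    rintro a (h1 | h1)
    · exact (pp_NN hα a).2 2 h1
    · exact (pp_NN hα a).1 h1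
  have r0 := hr 2 _ (hmem 0)
  have r1 := hr 2 _ (hmem 1)
  have v0 : ∀ α, Cyc α → rr α 2 (pp α 0) = -α ^ 4 := by
    intro α hα
    have hc : α ^ 4 + α ^ 3 + α ^ 2 + α + 1 = 0 := hα
    rw [rr, pp, rt_mk]
    simp [lf, cf, cz, ss, pv, pz, Z5.ev]
    linear_combination hc
  have v1 : ∀ α, rr α 2 (pp α 1) = -α := by
    intro α
    rw [rr, pp, rt_mk]
    simp [lf, cf, cz, ss, pv, pz, Z5.ev]
  rw [f0, v0 β hβ, v0 α hα] at r0
  rw [f1, v1, v1, ← g5] at r1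
  have hα0 := hα.ne
  have hβ0 := hβ.ne
  generalize Complex.exp (g 2 (pp α 0)) = E at r0 r1
  rcases hn0 with rfl | rfl
  · left
    rw [zpow_one] at r0 r1
    apply mul_left_cancel₀ (mul_ne_zero hα0 hβ0)
    linear_combination -α * r0 + α ^ 4 * r1
  · right
    rw [zpow_neg_one] at r0 r1
    field_simp at r0 r1
    apply mul_left_cancel₀ (mul_ne_zero hα0 hβ0)
    linear_combination r1 - r0


/-- For `i ≠ j ∈ {1,2,3,4}` with `i + j ≢ 0 (mod 5)`, there is no homeomorphism of
`ℂℙ²` with `h(Z(B^i)) = Z(B^j)`: `(B^i, B^j)` is a Zariski pair. -/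
theorem statement16 (ζ : ℂ) (hζ : ζ^4 + ζ^3 + ζ^2 + ζ + 1 = 0)
    (i j : ℕ) (hi : i ∈ Finset.Icc 1 4) (hj : j ∈ Finset.Icc 1 4)
    (hij : i ≠ j) (hmod : ¬ (5 ∣ i + j)) :
    ¬ ∃ h : CP2 ≃ₜ CP2, h '' (⋃ k, B2line (ζ^i) k) = ⋃ k, B2line (ζ^j) k := by
  rintro ⟨h, hh⟩
  simp only [B2line_eq] at hh
  rw [Finset.mem_Icc] at hi hj
  have hz : Cyc ζ := hζ
  have hp := hz.prim
  have hcyc : ∀ i, 1 ≤ i ∧ i ≤ 4 → Cyc (ζ ^ i) := by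
    intro i hi
    have h5 : (ζ ^ i) ^ 5 = 1 := by rw [← pow_mul, mul_comm, pow_mul, hz.five, one_pow]
    have h1 : ζ ^ i - 1 ≠ 0 := by
      rw [sub_ne_zero, Ne, hp.pow_eq_one_iff_dvd]
      omega
    apply mul_left_cancel₀ h1
    linear_combination h5
  have hα := hcyc i hi
  have hβ := hcyc j hj
  rcases final hα hβ h (lines_fixed hα hβ h hh) with h1 | h1
  · have : ζ ^ (3 * j + (15 - 3 * i)) = 1 := by
      rw [pow_add, mul_comm 3 j, pow_mul, h1, ← pow_mul, ← pow_add,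
        show i * 3 + (15 - 3 * i) = 5 * 3 by omega, pow_mul, hz.five, one_pow]
    rw [hp.pow_eq_one_iff_dvd] at this
    omega
  · rw [← mul_pow, ← pow_add, ← pow_mul, hp.pow_eq_one_iff_dvd] at h1
    omega
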